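/- arXiv:0708.3385 — 4 statements merged into one kernel-verified Lean document; each statement's English description precedes it below -/
import Mathlib

section
/- For every integer n and every w ∈ F, the element (xⁿ)^w lies in H, and ψ((xⁿ)^w) = (yⁿ)^{ψ(w)} if w ∈ H, while ψ((xⁿ)^w) = 1 if w ∉ H. -/
/-- F is the free group on two generators x and y. -/
abbrev F : Type := FreeGroup Bool

def x : F := FreeGroup.of false
def y : F := FreeGroup.of true

/-- The homomorphism F → ℤ/2ℤ sending x ↦ 0 and y ↦ 1. -/
def toZ2 : F →* Multiplicative (ZMod 2) :=
  FreeGroup.lift fun s => Multiplicative.ofAdd (if s then (1 : ZMod 2) else 0)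

/-- H is the kernel: the elements whose total exponent sum in y is even. -/
def H : Subgroup F := toZ2.ker

theorem x_mem_H : x ∈ H := by
  simp [H, toZ2, x, MonoidHom.mem_ker]

theorem conj_x_zpow_mem_H (n : ℤ) (w : F) : w⁻¹ * x ^ n * w ∈ H := by
  have hn : H.Normal := MonoidHom.normal_ker toZ2
  simpa using hn.conj_mem _ (H.zpow_mem x_mem_H n) w⁻¹

theorem y_inv_mul_mem_H {w : F} (hw : w ∉ H) : y⁻¹ * w ∈ H := by
  have dichotomy : ∀ a : Multiplicative (ZMod 2), a ≠ 1 → (Multiplicative.ofAdd 1)⁻¹ * a = 1 := by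
    decide
  have hy : toZ2 y = Multiplicative.ofAdd 1 := by simp [toZ2, y]
  rw [H, MonoidHom.mem_ker] at hw ⊢
  rw [map_mul, map_inv, hy]
  exact dichotomy _ hw

/-- For every n ∈ ℤ and w ∈ F, (xⁿ)^w ∈ H, and ψ((xⁿ)^w) = (yⁿ)^{ψ(w)} if w ∈ H,
while ψ((xⁿ)^w) = 1 if w ∉ H. -/
theorem stmt1 (ψ : H →* F)
    (hψx : ∀ u : H, (u : F) = x → ψ u = y)
    (hψy2 : ∀ u : H, (u : F) = y ^ 2 → ψ u = y⁻¹ * x⁻¹)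
    (hψc : ∀ u : H, (u : F) = y⁻¹ * x * y → ψ u = 1)
    (n : ℤ) (w : F) :
    w⁻¹ * x ^ n * w ∈ H ∧
    ∀ h : w⁻¹ * x ^ n * w ∈ H,
      (∀ hw : w ∈ H,
        ψ ⟨w⁻¹ * x ^ n * w, h⟩ = (ψ ⟨w, hw⟩)⁻¹ * y ^ n * ψ ⟨w, hw⟩) ∧
      (w ∉ H → ψ ⟨w⁻¹ * x ^ n * w, h⟩ = 1) := by
  refine ⟨conj_x_zpow_mem_H n w, fun h => ⟨fun hw => ?_, fun hw => ?_⟩⟩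
  · have key : (⟨w⁻¹ * x ^ n * w, h⟩ : H) = ⟨w, hw⟩⁻¹ * ⟨x, x_mem_H⟩ ^ n * ⟨w, hw⟩ :=
      Subtype.ext (by simp)
    rw [key, map_mul, map_mul, map_inv, map_zpow, hψx ⟨x, x_mem_H⟩ rfl]
  · have hc : y⁻¹ * x * y ∈ H := by simpa using conj_x_zpow_mem_H 1 y
    have hv := y_inv_mul_mem_H hw
    have hpow : (y⁻¹ * x * y) ^ n = y⁻¹ * x ^ n * y := by
      simpa using conj_zpow (i := n) (a := y⁻¹) (b := x)
    have key : (⟨w⁻¹ * x ^ n * w, h⟩ : H) =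
        ⟨y⁻¹ * w, hv⟩⁻¹ * ⟨y⁻¹ * x * y, hc⟩ ^ n * ⟨y⁻¹ * w, hv⟩ :=
      Subtype.ext (by push_cast; rw [hpow]; group)
    rw [key, map_mul, map_mul, map_inv, map_zpow, hψc ⟨y⁻¹ * x * y, hc⟩ rfl]
    simp
end

section
/- Set z = y⁻¹x⁻¹. For every integer n and every w ∈ F, the element (y^{2n})^w lies in H, and ψ((y^{2n})^w) = (zⁿ)^{ψ(w)} if w ∈ H, while ψ((y^{2n})^w) = (zⁿ)^{ψ(y⁻¹w)} if w ∉ H (note that y⁻¹w ∈ H when w ∉ H). -/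
theorem toZ2_y : toZ2 y = Multiplicative.ofAdd 1 := by
  simp [toZ2, y]

theorem y_sq_mem_H : y ^ 2 ∈ H := by
  rw [H, MonoidHom.mem_ker, map_pow, toZ2_y]
  decide

theorem conj_y_zpow_mem_H (n : ℤ) (w : F) : w⁻¹ * y ^ (2 * n) * w ∈ H := by
  have hH : H.Normal := by unfold H; infer_instance
  have hy : y ^ (2 * n) ∈ H := by
    rw [zpow_mul]
    exact H.zpow_mem (by exact_mod_cast y_sq_mem_H) n
  simpa using hH.conj_mem _ hy w⁻¹

/-- A homomorphism on `H` sends the conjugate of `y ^ (2 * n)` by `v ∈ H` to the conjugate of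
the `n`-th power of the image of `y ^ 2`. -/
theorem map_conj_y_zpow {G : Type*} [Group G] (ψ : H →* G) (n : ℤ) (u v : H)
    (huv : (u : F) = (v : F)⁻¹ * y ^ (2 * n) * v) :
    ψ u = (ψ v)⁻¹ * ψ ⟨y ^ 2, y_sq_mem_H⟩ ^ n * ψ v := by
  have hu : u = v⁻¹ * ⟨y ^ 2, y_sq_mem_H⟩ ^ n * v := by
    ext1
    simp [huv, zpow_mul]
  rw [hu, map_mul, map_mul, map_inv, map_zpow]

/-- With z = y⁻¹x⁻¹: for every n ∈ ℤ and w ∈ F, (y^{2n})^w ∈ H, y⁻¹w ∈ H whenever w ∉ H,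
and ψ((y^{2n})^w) = (zⁿ)^{ψ(w)} if w ∈ H, while ψ((y^{2n})^w) = (zⁿ)^{ψ(y⁻¹w)} if w ∉ H. -/
theorem stmt2 (ψ : H →* F)
    (hψx : ∀ u : H, (u : F) = x → ψ u = y)
    (hψy2 : ∀ u : H, (u : F) = y ^ 2 → ψ u = y⁻¹ * x⁻¹)
    (hψc : ∀ u : H, (u : F) = y⁻¹ * x * y → ψ u = 1)
    (n : ℤ) (w : F) :
    w⁻¹ * y ^ (2 * n) * w ∈ H ∧
    (w ∉ H → y⁻¹ * w ∈ H) ∧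
    ∀ h : w⁻¹ * y ^ (2 * n) * w ∈ H,
      (∀ hw : w ∈ H,
        ψ ⟨w⁻¹ * y ^ (2 * n) * w, h⟩ =
          (ψ ⟨w, hw⟩)⁻¹ * (y⁻¹ * x⁻¹) ^ n * ψ ⟨w, hw⟩) ∧
      (w ∉ H → ∀ hw : y⁻¹ * w ∈ H,
        ψ ⟨w⁻¹ * y ^ (2 * n) * w, h⟩ =
          (ψ ⟨y⁻¹ * w, hw⟩)⁻¹ * (y⁻¹ * x⁻¹) ^ n * ψ ⟨y⁻¹ * w, hw⟩) := by
  refine ⟨conj_y_zpow_mem_H n w, y_inv_mul_mem_H, fun h => ⟨fun hw => ?_, fun _ hw => ?_⟩⟩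
  · rw [← hψy2 ⟨y ^ 2, y_sq_mem_H⟩ rfl]
    exact map_conj_y_zpow ψ n _ _ rfl
  · rw [← hψy2 ⟨y ^ 2, y_sq_mem_H⟩ rfl]
    refine map_conj_y_zpow ψ n _ _ ?_
    change w⁻¹ * y ^ (2 * n) * w = (y⁻¹ * w)⁻¹ * y ^ (2 * n) * (y⁻¹ * w)
    group
end

section
/- Set z = y⁻¹x⁻¹. For every integer n and every w ∈ F, the element (z^{2n})^w lies in H, and ψ((z^{2n})^w) = (xⁿ)^{ψ(w)} if w ∈ H, while ψ((z^{2n})^w) = (xⁿ)^{ψ(y⁻¹w)} if w ∉ H (note that y⁻¹w ∈ H when w ∉ H). -/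
theorem inv_mul_mul_mem_H {g : F} (hg : g ∈ H) (w : F) : w⁻¹ * g * w ∈ H :=
  (MonoidHom.normal_ker toZ2).conj_mem' g hg w

/-- With z = y⁻¹x⁻¹: for every n ∈ ℤ and w ∈ F, (z^{2n})^w ∈ H, y⁻¹w ∈ H whenever w ∉ H,
and ψ((z^{2n})^w) = (xⁿ)^{ψ(w)} if w ∈ H, while ψ((z^{2n})^w) = (xⁿ)^{ψ(y⁻¹w)} if w ∉ H. -/
theorem stmt3 (ψ : H →* F)
    (hψx : ∀ u : H, (u : F) = x → ψ u = y)
    (hψy2 : ∀ u : H, (u : F) = y ^ 2 → ψ u = y⁻¹ * x⁻¹)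
    (hψc : ∀ u : H, (u : F) = y⁻¹ * x * y → ψ u = 1)
    (n : ℤ) (w : F) :
    w⁻¹ * (y⁻¹ * x⁻¹) ^ (2 * n) * w ∈ H ∧
    (w ∉ H → y⁻¹ * w ∈ H) ∧
    ∀ h : w⁻¹ * (y⁻¹ * x⁻¹) ^ (2 * n) * w ∈ H,
      (∀ hw : w ∈ H,
        ψ ⟨w⁻¹ * (y⁻¹ * x⁻¹) ^ (2 * n) * w, h⟩ =
          (ψ ⟨w, hw⟩)⁻¹ * x ^ n * ψ ⟨w, hw⟩) ∧
      (w ∉ H → ∀ hw : y⁻¹ * w ∈ H,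
        ψ ⟨w⁻¹ * (y⁻¹ * x⁻¹) ^ (2 * n) * w, h⟩ =
          (ψ ⟨y⁻¹ * w, hw⟩)⁻¹ * x ^ n * ψ ⟨y⁻¹ * w, hw⟩) := by
  let a : H := ⟨x, x_mem_H⟩
  let b : H := ⟨y ^ 2, y_sq_mem_H⟩
  let c : H := ⟨y⁻¹ * x * y, inv_mul_mul_mem_H x_mem_H y⟩
  have ha : ψ a = y := hψx a rfl
  have hb : ψ b = y⁻¹ * x⁻¹ := hψy2 b rfl
  have hc : ψ c = 1 := hψc c rfl
  have hz : ((c⁻¹ * b⁻¹ * a⁻¹ : H) : F) = (y⁻¹ * x⁻¹) ^ (2 : ℤ) := by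
    simp only [a, b, c, Subgroup.coe_mul, Subgroup.coe_inv, zpow_two]
    group
  have hzy : ((b⁻¹ * a⁻¹ * c⁻¹ : H) : F) = y⁻¹ * (y⁻¹ * x⁻¹) ^ (2 : ℤ) * (y⁻¹)⁻¹ := by
    simp only [a, b, c, Subgroup.coe_mul, Subgroup.coe_inv, zpow_two]
    group
  refine ⟨?_, y_inv_mul_mem_H, fun h => ⟨fun hw => ?_, fun _ hw => ?_⟩⟩
  · have hmem : (y⁻¹ * x⁻¹) ^ (2 * n) ∈ H := by
      rw [zpow_mul, ← hz]
      exact H.zpow_mem (SetLike.coe_mem _) n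
    exact inv_mul_mul_mem_H hmem w
  · have e : (⟨w⁻¹ * (y⁻¹ * x⁻¹) ^ (2 * n) * w, h⟩ : H) =
        ⟨w, hw⟩⁻¹ * (c⁻¹ * b⁻¹ * a⁻¹) ^ n * ⟨w, hw⟩ := by
      ext1
      rw [Subgroup.coe_mul, Subgroup.coe_mul, Subgroup.coe_zpow, hz, ← zpow_mul]
      rfl
    rw [e]
    simp [ha, hb, hc]
  · have e : (⟨w⁻¹ * (y⁻¹ * x⁻¹) ^ (2 * n) * w, h⟩ : H) =
        ⟨y⁻¹ * w, hw⟩⁻¹ * (b⁻¹ * a⁻¹ * c⁻¹) ^ n * ⟨y⁻¹ * w, hw⟩ := by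
      ext1
      rw [Subgroup.coe_mul, Subgroup.coe_mul, Subgroup.coe_zpow, hzy, conj_zpow, ← zpow_mul,
        Subgroup.coe_inv]
      simp only [mul_inv_rev, inv_inv]
      group
    rw [e]
    simp [ha, hb, hc]
end

section
/- Set z = y⁻¹x⁻¹. For every u ∈ {x, y, z} and every w ∈ F there exists a natural number k such that the element (u^{2^k})^w belongs to dom(ψ^{∘k}), and ψ^{∘k}((u^{2^k})^w) is a power of x, of y, or of z; that is, there exist u' ∈ {x, y, z} and s ∈ ℤ with ψ^{∘k}((u^{2^k})^w) = u'^s. -/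
/-- g ∈ dom(ψ^{∘k}): dom(ψ^{∘0}) = F and dom(ψ^{∘(k+1)}) = {g ∈ H : ψ(g) ∈ dom(ψ^{∘k})}. -/
def inDom (ψ : H →* F) : ℕ → F → Prop
  | 0, _ => True
  | k + 1, g => ∃ h : g ∈ H, inDom ψ k (ψ ⟨g, h⟩)

open scoped Classical in
/-- The iterate ψ^{∘k}: ψ^{∘0} = id and ψ^{∘(k+1)}(g) = ψ^{∘k}(ψ(g))
(with junk value 1 outside the domain). -/
noncomputable def iterPsi (ψ : H →* F) : ℕ → F → F
  | 0, g => g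
  | k + 1, g => if h : g ∈ H then iterPsi ψ k (ψ ⟨g, h⟩) else 1

local notation "z" => (y⁻¹ * x⁻¹)

/-- `PsiMaps ψ g v`: the element `g` lies in the domain `H` of `ψ` and has image `v`. -/
def PsiMaps (ψ : H →* F) (g v : F) : Prop := ∃ h : g ∈ H, ψ ⟨g, h⟩ = v

namespace PsiMaps

variable {ψ : H →* F} {g g' v v' : F}

theorem one : PsiMaps ψ 1 1 := ⟨H.one_mem, map_one ψ⟩

theorem mul (h : PsiMaps ψ g v) (h' : PsiMaps ψ g' v') : PsiMaps ψ (g * g') (v * v') := by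
  obtain ⟨h, rfl⟩ := h
  obtain ⟨h', rfl⟩ := h'
  exact ⟨H.mul_mem h h', map_mul ψ ⟨g, h⟩ ⟨g', h'⟩⟩

theorem inv (h : PsiMaps ψ g v) : PsiMaps ψ g⁻¹ v⁻¹ := by
  obtain ⟨h, rfl⟩ := h
  exact ⟨H.inv_mem h, map_inv ψ ⟨g, h⟩⟩

theorem pow (h : PsiMaps ψ g v) (n : ℕ) : PsiMaps ψ (g ^ n) (v ^ n) := by
  obtain ⟨h, rfl⟩ := h
  exact ⟨H.pow_mem h n, map_pow ψ ⟨g, h⟩ n⟩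

theorem congr (h : PsiMaps ψ g v) (hg : g = g') (hv : v = v') : PsiMaps ψ g' v' :=
  hg ▸ hv ▸ h

theorem conj (h : PsiMaps ψ g v) (h' : PsiMaps ψ g' v') :
    PsiMaps ψ (g'⁻¹ * g * g') (v'⁻¹ * v * v') :=
  (h'.inv.mul h).mul h'

end PsiMaps

/-- `w ∈ H` has sections `a` and `b` at the cosets of `1` and `y`. -/
def EvenSections (ψ : H →* F) (w a b : F) : Prop :=
  PsiMaps ψ w a ∧ PsiMaps ψ (y * w * y⁻¹) b

/-- `w ∉ H` has sections `a` and `b` at the cosets of `1` and `y`. -/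
def OddSections (ψ : H →* F) (w a b : F) : Prop :=
  PsiMaps ψ (w * y⁻¹) a ∧ PsiMaps ψ (y * w) b

section Sections

variable {ψ : H →* F} {w w' a b c d : F}

theorem EvenSections.mul_even (h : EvenSections ψ w a b) (h' : EvenSections ψ w' c d) :
    EvenSections ψ (w * w') (a * c) (b * d) :=
  ⟨h.1.mul h'.1, (h.2.mul h'.2).congr (by group) rfl⟩

theorem EvenSections.mul_odd (h : EvenSections ψ w a b) (h' : OddSections ψ w' c d) :
    OddSections ψ (w * w') (a * c) (b * d) :=
  ⟨(h.1.mul h'.1).congr (by group) rfl, (h.2.mul h'.2).congr (by group) rfl⟩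

theorem OddSections.mul_even (h : OddSections ψ w a b) (h' : EvenSections ψ w' c d) :
    OddSections ψ (w * w') (a * d) (b * c) :=
  ⟨(h.1.mul h'.2).congr (by group) rfl, (h.2.mul h'.1).congr (by group) rfl⟩

theorem OddSections.mul_odd (h : OddSections ψ w a b) (h' : OddSections ψ w' c d) :
    EvenSections ψ (w * w') (a * d) (b * c) :=
  ⟨(h.1.mul h'.2).congr (by group) rfl, (h.2.mul h'.1).congr (by group) rfl⟩

theorem EvenSections.inv (h : EvenSections ψ w a b) : EvenSections ψ w⁻¹ a⁻¹ b⁻¹ :=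
  ⟨h.1.inv, h.2.inv.congr (by group) rfl⟩

theorem OddSections.inv (h : OddSections ψ w a b) : OddSections ψ w⁻¹ b⁻¹ a⁻¹ :=
  ⟨h.2.inv.congr (by group) rfl, h.1.inv.congr (by group) rfl⟩

theorem EvenSections.one : EvenSections ψ 1 1 1 :=
  ⟨.one, PsiMaps.one.congr (by group) rfl⟩

end Sections

/-- The defining values of the virtual endomorphism of the rabbit. -/
structure IsRabbit (ψ : H →* F) : Prop where
  map_x : PsiMaps ψ x y
  map_y_sq : PsiMaps ψ (y ^ 2) z
  map_conj : PsiMaps ψ (y⁻¹ * x * y) 1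

namespace IsRabbit

variable {ψ : H →* F}

theorem sections_x (hψ : IsRabbit ψ) : EvenSections ψ x y 1 :=
  ⟨hψ.map_x, (hψ.map_conj.conj hψ.map_y_sq.inv).congr (by group) (by group)⟩

theorem sections_y (hψ : IsRabbit ψ) : OddSections ψ y 1 z :=
  ⟨PsiMaps.one.congr (by group) rfl, hψ.map_y_sq.congr (pow_two y) rfl⟩

theorem sections_z (hψ : IsRabbit ψ) : OddSections ψ z (z)⁻¹ y⁻¹ := by
  simpa using hψ.sections_y.inv.mul_even hψ.sections_x.inv

theorem map_z_sq (hψ : IsRabbit ψ) : PsiMaps ψ (z ^ 2) x :=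
  (hψ.sections_z.mul_odd hψ.sections_z).1.congr (pow_two _).symm (by group)

end IsRabbit

/-- All iterated sections of `w` along sufficiently long paths lie in `{1, y, y⁻¹, z, z⁻¹}`. -/
inductive Contracts (ψ : H →* F) : F → Prop
  | one : Contracts ψ 1
  | gen_y : Contracts ψ y
  | gen_z : Contracts ψ z
  | gen_y_inv : Contracts ψ y⁻¹
  | gen_z_inv : Contracts ψ (z)⁻¹
  | even {w a b : F} : EvenSections ψ w a b → Contracts ψ a → Contracts ψ b → Contracts ψ w
  | odd {w a b : F} : OddSections ψ w a b → Contracts ψ a → Contracts ψ b → Contracts ψ w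

namespace Contracts

variable {ψ : H →* F} {w w' : F}

theorem inv (h : Contracts ψ w) : Contracts ψ w⁻¹ := by
  induction h with
  | one => exact inv_one (G := F) ▸ one
  | gen_y => exact gen_y_inv
  | gen_z => exact gen_z_inv
  | gen_y_inv => exact (inv_inv y).symm ▸ gen_y
  | gen_z_inv => exact (inv_inv z).symm ▸ gen_z
  | even h _ _ iha ihb => exact even h.inv iha ihb
  | odd h _ _ iha ihb => exact odd h.inv ihb iha

theorem congr (h : Contracts ψ w) (hw : w = w') : Contracts ψ w' := hw ▸ h

end Contracts

namespace IsRabbit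

variable {ψ : H →* F}

theorem contracts_x (hψ : IsRabbit ψ) : Contracts ψ x := .even hψ.sections_x .gen_y .one

theorem contracts_z_mul_y (hψ : IsRabbit ψ) : Contracts ψ (z * y) :=
  .even (hψ.sections_z.mul_odd hψ.sections_y) (Contracts.one.congr (by group))
    (Contracts.gen_y_inv.congr (by group))

theorem contracts_y_mul_y (hψ : IsRabbit ψ) : Contracts ψ (y * y) :=
  .even (hψ.sections_y.mul_odd hψ.sections_y) (Contracts.gen_z.congr (by group))
    (Contracts.gen_z.congr (by group))

theorem contracts_z_mul_y_inv (hψ : IsRabbit ψ) : Contracts ψ (z * y⁻¹) :=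
  .even (hψ.sections_z.mul_odd hψ.sections_y.inv) (Contracts.gen_z_inv.congr (by group))
    (hψ.contracts_z_mul_y.inv.congr (by group))

theorem contracts_y_mul_x (hψ : IsRabbit ψ) : Contracts ψ (y * x) :=
  .odd (hψ.sections_y.mul_even hψ.sections_x) (Contracts.one.congr (by group))
    hψ.contracts_z_mul_y

theorem contracts_y_mul_x_inv (hψ : IsRabbit ψ) : Contracts ψ (y * x⁻¹) :=
  .odd (hψ.sections_y.mul_even hψ.sections_x.inv) (Contracts.one.congr (by group))
    hψ.contracts_z_mul_y_inv

theorem contracts_y_inv_mul_x (hψ : IsRabbit ψ) : Contracts ψ (y⁻¹ * x) :=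
  .odd (hψ.sections_y.inv.mul_even hψ.sections_x) (Contracts.gen_z_inv.congr (by group))
    (Contracts.gen_y.congr (by group))

theorem contracts_z_inv_mul_y (hψ : IsRabbit ψ) : Contracts ψ ((z)⁻¹ * y) :=
  .even (hψ.sections_z.inv.mul_odd hψ.sections_y) (hψ.contracts_x.inv.congr (by group))
    (Contracts.gen_z.congr (by group))

theorem contracts_z_mul_x_inv (hψ : IsRabbit ψ) : Contracts ψ (z * x⁻¹) :=
  .odd (hψ.sections_z.mul_even hψ.sections_x.inv) (Contracts.gen_z_inv.congr (by group))
    (hψ.contracts_y_mul_y.inv.congr (by group))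

theorem contracts_z_mul_z (hψ : IsRabbit ψ) : Contracts ψ (z * z) :=
  .even (hψ.sections_z.mul_odd hψ.sections_z) (hψ.contracts_x.congr (by group))
    (hψ.contracts_z_mul_y.inv.congr (by group))

theorem contracts_z_inv_mul_x (hψ : IsRabbit ψ) : Contracts ψ ((z)⁻¹ * x) :=
  .odd (hψ.sections_z.inv.mul_even hψ.sections_x) (Contracts.gen_y.congr (by group))
    (hψ.contracts_z_mul_y.congr (by group))

theorem contracts_z_inv_mul_x_inv (hψ : IsRabbit ψ) : Contracts ψ ((z)⁻¹ * x⁻¹) :=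
  .odd (hψ.sections_z.inv.mul_even hψ.sections_x.inv) (Contracts.gen_y.congr (by group))
    (hψ.contracts_z_mul_y_inv.congr (by group))

end IsRabbit

/-- A generating set of `F` that is closed under sections. -/
inductive IsLetter : F → Prop
  | one : IsLetter 1
  | gen_x : IsLetter x
  | gen_x_inv : IsLetter x⁻¹
  | gen_y : IsLetter y
  | gen_y_inv : IsLetter y⁻¹
  | gen_z : IsLetter z
  | gen_z_inv : IsLetter (z)⁻¹

theorem IsLetter.inv {s : F} (hs : IsLetter s) : IsLetter s⁻¹ := by
  cases hs with
  | one => exact inv_one (G := F) ▸ one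
  | gen_x => exact gen_x_inv
  | gen_x_inv => exact (inv_inv x).symm ▸ gen_x
  | gen_y => exact gen_y_inv
  | gen_y_inv => exact (inv_inv y).symm ▸ gen_y
  | gen_z => exact gen_z_inv
  | gen_z_inv => exact (inv_inv z).symm ▸ gen_z

namespace IsRabbit

variable {ψ : H →* F}

theorem exists_sections_of_isLetter (hψ : IsRabbit ψ) {s : F} (hs : IsLetter s) :
    ∃ a b, IsLetter a ∧ IsLetter b ∧ (EvenSections ψ s a b ∨ OddSections ψ s a b) := by
  cases hs with
  | one => exact ⟨_, _, .one, .one, .inl .one⟩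
  | gen_x => exact ⟨_, _, .gen_y, .one, .inl hψ.sections_x⟩
  | gen_x_inv => exact ⟨_, _, .gen_y_inv, IsLetter.one.inv, .inl hψ.sections_x.inv⟩
  | gen_y => exact ⟨_, _, .one, .gen_z, .inr hψ.sections_y⟩
  | gen_y_inv => exact ⟨_, _, .gen_z_inv, IsLetter.one.inv, .inr hψ.sections_y.inv⟩
  | gen_z => exact ⟨_, _, .gen_z_inv, .gen_y_inv, .inr hψ.sections_z⟩
  | gen_z_inv => exact ⟨_, _, IsLetter.gen_y_inv.inv, IsLetter.gen_z_inv.inv, .inr hψ.sections_z.inv⟩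

theorem contracts_of_isLetter (hψ : IsRabbit ψ) {s : F} (hs : IsLetter s) : Contracts ψ s := by
  cases hs with
  | one => exact .one
  | gen_x => exact hψ.contracts_x
  | gen_x_inv => exact hψ.contracts_x.inv
  | gen_y => exact .gen_y
  | gen_y_inv => exact .gen_y_inv
  | gen_z => exact .gen_z
  | gen_z_inv => exact .gen_z_inv

theorem contracts_mul_letter (hψ : IsRabbit ψ) {w s : F} (hw : Contracts ψ w)
    (hs : IsLetter s) : Contracts ψ (w * s) := by
  induction hw generalizing s with
  | one => exact (hψ.contracts_of_isLetter hs).congr (by group)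
  | gen_y =>
    cases hs with
    | one => exact Contracts.gen_y.congr (by group)
    | gen_x => exact hψ.contracts_y_mul_x
    | gen_x_inv => exact hψ.contracts_y_mul_x_inv
    | gen_y => exact hψ.contracts_y_mul_y
    | gen_y_inv => exact Contracts.one.congr (by group)
    | gen_z => exact hψ.contracts_x.inv.congr (by group)
    | gen_z_inv => exact hψ.contracts_z_mul_y_inv.inv.congr (by group)
  | gen_z =>
    cases hs with
    | one => exact Contracts.gen_z.congr (by group)
    | gen_x => exact Contracts.gen_y_inv.congr (by group)
    | gen_x_inv => exact hψ.contracts_z_mul_x_inv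
    | gen_y => exact hψ.contracts_z_mul_y
    | gen_y_inv => exact hψ.contracts_z_mul_y_inv
    | gen_z => exact hψ.contracts_z_mul_z
    | gen_z_inv => exact Contracts.one.congr (by group)
  | gen_y_inv =>
    cases hs with
    | one => exact Contracts.gen_y_inv.congr (by group)
    | gen_x => exact hψ.contracts_y_inv_mul_x
    | gen_x_inv => exact Contracts.gen_z
    | gen_y => exact Contracts.one.congr (by group)
    | gen_y_inv => exact hψ.contracts_y_mul_y.inv.congr (by group)
    | gen_z => exact hψ.contracts_z_inv_mul_y.inv.congr (by group)
    | gen_z_inv => exact hψ.contracts_z_mul_y.inv.congr (by group)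
  | gen_z_inv =>
    cases hs with
    | one => exact Contracts.gen_z_inv.congr (by group)
    | gen_x => exact hψ.contracts_z_inv_mul_x
    | gen_x_inv => exact hψ.contracts_z_inv_mul_x_inv
    | gen_y => exact hψ.contracts_z_inv_mul_y
    | gen_y_inv => exact hψ.contracts_x.congr (by group)
    | gen_z => exact Contracts.one.congr (by group)
    | gen_z_inv => exact hψ.contracts_z_mul_z.inv.congr (by group)
  | even h _ _ iha ihb =>
    obtain ⟨c, d, hc, hd, h' | h'⟩ := hψ.exists_sections_of_isLetter hs
    · exact .even (h.mul_even h') (iha hc) (ihb hd)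
    · exact .odd (h.mul_odd h') (iha hc) (ihb hd)
  | odd h _ _ iha ihb =>
    obtain ⟨c, d, hc, hd, h' | h'⟩ := hψ.exists_sections_of_isLetter hs
    · exact .odd (h.mul_even h') (iha hd) (ihb hc)
    · exact .even (h.mul_odd h') (iha hd) (ihb hc)

theorem contracts_mul (hψ : IsRabbit ψ) (w : F) {v : F} (hv : Contracts ψ v) :
    Contracts ψ (v * w) := by
  induction w using FreeGroup.induction_on generalizing v with
  | C1 => exact hv.congr (mul_one v).symm
  | of s => cases s with
    | false => exact hψ.contracts_mul_letter hv .gen_x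
    | true => exact hψ.contracts_mul_letter hv .gen_y
  | inv_of s _ => cases s with
    | false => exact hψ.contracts_mul_letter hv .gen_x_inv
    | true => exact hψ.contracts_mul_letter hv .gen_y_inv
  | mul w₁ w₂ h₁ h₂ => exact (h₂ (h₁ hv)).congr (mul_assoc v w₁ w₂)

theorem contracts (hψ : IsRabbit ψ) (w : F) : Contracts ψ w :=
  (hψ.contracts_mul w .one).congr (one_mul w)

end IsRabbit

/-- Some iterate of `ψ` is defined at the conjugates by `w` of all sufficiently 2-divisible powers
of `u`, and sends them to powers of `x`, `y` or `z`. -/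
def ReachesCycle (ψ : H →* F) (u w : F) : Prop :=
  ∃ k : ℕ, ∀ m : ℕ, inDom ψ k (w⁻¹ * u ^ (2 ^ k * m) * w) ∧
    ∃ u' ∈ ({x, y, z} : Set F), ∃ s : ℤ, iterPsi ψ k (w⁻¹ * u ^ (2 ^ k * m) * w) = u' ^ s

namespace ReachesCycle

variable {ψ : H →* F} {u w u' w' : F}

theorem zpow (hu : u ∈ ({x, y, z} : Set F)) (n : ℤ) : ReachesCycle ψ u (u ^ n) := by
  refine ⟨0, fun m => ⟨trivial, u, hu, m, ?_⟩⟩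
  simp only [iterPsi]
  group

theorem step (h : ReachesCycle ψ u' w') (j : ℕ)
    (hψ : PsiMaps ψ (w⁻¹ * u ^ 2 * w) (w'⁻¹ * u' ^ j * w')) : ReachesCycle ψ u w := by
  obtain ⟨k, hk⟩ := h
  refine ⟨k + 1, fun m => ?_⟩
  have conj_pow_eq (a b : F) (n : ℕ) : (a⁻¹ * b * a) ^ n = a⁻¹ * b ^ n * a := by
    simpa using conj_pow (a := a⁻¹) (b := b) (i := n)
  obtain ⟨hH, hval⟩ : PsiMaps ψ (w⁻¹ * u ^ (2 ^ (k + 1) * m) * w)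
      (w'⁻¹ * u' ^ (2 ^ k * (j * m)) * w') := by
    refine (hψ.pow (2 ^ k * m)).congr ?_ ?_
    · rw [conj_pow_eq, ← pow_mul, pow_succ]
      congr 3
      ring
    · rw [conj_pow_eq, ← pow_mul]
      congr 3
      ring
  simpa only [inDom, iterPsi, hH, dite_true, exists_true_left, hval] using hk (j * m)

theorem step_trivial (hψ : PsiMaps ψ (w⁻¹ * u ^ 2 * w) 1) : ReachesCycle ψ u w :=
  (zpow (u := x) (by simp) 0).step 0 (hψ.congr rfl (by group))

end ReachesCycle

namespace IsRabbit

variable {ψ : H →* F} {w a b : F}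

theorem reachesCycle_x_of_even (hψ : IsRabbit ψ) (hw : EvenSections ψ w a b)
    (h : ReachesCycle ψ y a) : ReachesCycle ψ x w :=
  h.step 2 ((hψ.map_x.pow 2).conj hw.1)

theorem reachesCycle_x_of_odd (hψ : IsRabbit ψ) (hw : OddSections ψ w a b) :
    ReachesCycle ψ x w :=
  .step_trivial (((hψ.sections_x.2.pow 2).conj hw.2).congr (by simp [mul_assoc, sq]) (by simp))

theorem reachesCycle_x_y_mul_of_even (hψ : IsRabbit ψ) (hw : EvenSections ψ w a b) :
    ReachesCycle ψ x (y * w) :=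
  .step_trivial (((hψ.map_conj.pow 2).conj hw.1).congr (by simp [mul_assoc, sq]) (by simp))

theorem reachesCycle_x_y_mul_of_odd (hψ : IsRabbit ψ) (hw : OddSections ψ w a b)
    (h : ReachesCycle ψ y b) : ReachesCycle ψ x (y * w) :=
  h.step 2 ((hψ.map_x.pow 2).conj hw.2)

theorem reachesCycle_y_of_even (hψ : IsRabbit ψ) (hw : EvenSections ψ w a b)
    (h : ReachesCycle ψ z a) : ReachesCycle ψ y w :=
  h.step 1 ((hψ.map_y_sq.conj hw.1).congr rfl (by simp))

theorem reachesCycle_y_of_odd (hψ : IsRabbit ψ) (hw : OddSections ψ w a b)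
    (h : ReachesCycle ψ z b) : ReachesCycle ψ y w :=
  h.step 1 ((hψ.map_y_sq.conj hw.2).congr (by group) (by simp))

theorem reachesCycle_z_of_even (hψ : IsRabbit ψ) (hw : EvenSections ψ w a b)
    (h : ReachesCycle ψ x a) : ReachesCycle ψ z w :=
  h.step 1 ((hψ.map_z_sq.conj hw.1).congr rfl (by simp))

theorem reachesCycle_z_of_odd (hψ : IsRabbit ψ) (hw : OddSections ψ w a b)
    (h : ReachesCycle ψ x (y * b)) : ReachesCycle ψ z w :=
  h.step 1 ((hψ.map_z_sq.conj (hψ.map_x.mul hw.2)).congr (by simp [sq, mul_assoc]) (by simp))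

end IsRabbit

/-- The family of statements about `w` that is inherited from its two sections. -/
structure AllReachCycle (ψ : H →* F) (w : F) : Prop where
  at_x : ReachesCycle ψ x w
  at_x_y_mul : ReachesCycle ψ x (y * w)
  at_y : ReachesCycle ψ y w
  at_z : ReachesCycle ψ z w

namespace IsRabbit

variable {ψ : H →* F}

theorem allReachCycle (hψ : IsRabbit ψ) (w : F) : AllReachCycle ψ w := by
  have hx (n : ℤ) : ReachesCycle ψ x (x ^ n) := .zpow (by simp) n
  have hy (n : ℤ) : ReachesCycle ψ y (y ^ n) := .zpow (by simp) n
  have hz (n : ℤ) : ReachesCycle ψ z ((z) ^ n) := .zpow (by simp) n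
  have hx_y : ReachesCycle ψ x y := hψ.reachesCycle_x_of_odd hψ.sections_y
  have hx_y_mul_one_inv : ReachesCycle ψ x (y * 1⁻¹) := by simpa using hx_y
  have hz_y_inv : ReachesCycle ψ z y⁻¹ :=
    hψ.reachesCycle_z_of_odd hψ.sections_y.inv hx_y_mul_one_inv
  have hy_z : ReachesCycle ψ y z := hψ.reachesCycle_y_of_odd hψ.sections_z hz_y_inv
  induction hψ.contracts w with
  | one =>
    exact ⟨by simpa using hx 0, by simpa using hx_y, by simpa using hy 0, by simpa using hz 0⟩
  | gen_y =>
    exact ⟨hx_y, hψ.reachesCycle_x_y_mul_of_odd hψ.sections_y hy_z, by simpa using hy 1,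
      hψ.reachesCycle_z_of_odd hψ.sections_y (by simpa using hx (-1))⟩
  | gen_z =>
    exact ⟨hψ.reachesCycle_x_of_odd hψ.sections_z, by simpa using hx (-1), hy_z,
      by simpa only [zpow_one] using hz 1⟩
  | gen_y_inv =>
    exact ⟨hψ.reachesCycle_x_of_odd hψ.sections_y.inv, by simpa using hx 0,
      by simpa using hy (-1), hz_y_inv⟩
  | gen_z_inv =>
    have hs := hψ.sections_z.inv
    rw [inv_inv, inv_inv] at hs
    exact ⟨hψ.reachesCycle_x_of_odd hs, hψ.reachesCycle_x_y_mul_of_odd hs hy_z,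
      hψ.reachesCycle_y_of_odd hs (by simpa only [zpow_one] using hz 1),
      by simpa only [zpow_neg, zpow_one] using hz (-1)⟩
  | even h _ _ iha ihb =>
    exact ⟨hψ.reachesCycle_x_of_even h iha.at_y, hψ.reachesCycle_x_y_mul_of_even h,
      hψ.reachesCycle_y_of_even h iha.at_z, hψ.reachesCycle_z_of_even h iha.at_x⟩
  | odd h _ _ iha ihb =>
    exact ⟨hψ.reachesCycle_x_of_odd h, hψ.reachesCycle_x_y_mul_of_odd h ihb.at_y,
      hψ.reachesCycle_y_of_odd h ihb.at_z, hψ.reachesCycle_z_of_odd h ihb.at_x_y_mul⟩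

end IsRabbit

/-- With z = y⁻¹x⁻¹: for every u ∈ {x, y, z} and w ∈ F there is k ∈ ℕ such that
(u^{2^k})^w ∈ dom(ψ^{∘k}) and ψ^{∘k}((u^{2^k})^w) is a power of x, of y, or of z. -/
theorem stmt7 (ψ : H →* F)
    (hψx : ∀ u : H, (u : F) = x → ψ u = y)
    (hψy2 : ∀ u : H, (u : F) = y ^ 2 → ψ u = y⁻¹ * x⁻¹)
    (hψc : ∀ u : H, (u : F) = y⁻¹ * x * y → ψ u = 1)
    (u : F) (hu : u ∈ ({x, y, y⁻¹ * x⁻¹} : Set F)) (w : F) :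
    ∃ k : ℕ, inDom ψ k (w⁻¹ * u ^ (2 ^ k : ℕ) * w) ∧
      ∃ u' ∈ ({x, y, y⁻¹ * x⁻¹} : Set F), ∃ s : ℤ,
        iterPsi ψ k (w⁻¹ * u ^ (2 ^ k : ℕ) * w) = u' ^ s := by
  have mem_x : x ∈ H := by simp [H, MonoidHom.mem_ker, toZ2, x]
  have mem_y_sq : y ^ 2 ∈ H := by
    rw [H, MonoidHom.mem_ker, map_pow]
    simp only [toZ2, y, FreeGroup.lift_apply_of]
    decide
  have mem_conj : y⁻¹ * x * y ∈ H := by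
    have hH : H.Normal := MonoidHom.normal_ker toZ2
    simpa using hH.conj_mem x mem_x y⁻¹
  have hψ : IsRabbit ψ :=
    ⟨⟨mem_x, hψx _ rfl⟩, ⟨mem_y_sq, hψy2 _ rfl⟩, ⟨mem_conj, hψc _ rfl⟩⟩
  obtain ⟨k, hk⟩ : ReachesCycle ψ u w := by
    obtain rfl | rfl | rfl := hu
    · exact (hψ.allReachCycle w).at_x
    · exact (hψ.allReachCycle w).at_y
    · exact (hψ.allReachCycle w).at_z
  exact ⟨k, by simpa only [mul_one] using hk 1⟩
end
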